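/- Let A and B be coaugmented chain coalgebras over a commutative ring R of characteristic 2, and let h be the natural degree +1 homotopy on Ω(A⊗B). Then for all b ∈ B̄ and a_1, …, a_n ∈ Ā, (dh + hd)[b | a_1 | ⋯ | a_n] = [a_1 | ⋯ | a_n | b] + [b | a_1 | ⋯ | a_n]. -/

import Mathlib

open scoped TensorProduct
open DirectSum

noncomputable section
namespace CJ2

/-- Cast along an equality of indices in a graded module. -/
def pcast {R : Type} [CommRing R] {A : ℕ → Type} [∀ n, AddCommGroup (A n)]
    [∀ n, Module R (A n)] {m n : ℕ} (h : m = n) : A m →ₗ[R] A n where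
  toFun x := h ▸ x
  map_add' := by subst h; intros; rfl
  map_smul' := by subst h; intros; rfl

/-- A coaugmented chain coalgebra over `R`, presented componentwise: a non-negatively
graded `R`-module `A` with differential `d` of degree `-1`, comultiplication given by
its components `comul p q : A (p+q) → A p ⊗ A q`, counit and coaugmentation, subject to
the usual axioms (coassociativity, counit laws, co-Leibniz rule, `d² = 0`). -/
structure CoalgStr (R : Type) [CommRing R] (A : ℕ → Type)
    [∀ n, AddCommGroup (A n)] [∀ n, Module R (A n)] where
  d : ∀ n, A (n+1) →ₗ[R] A n
  dd : ∀ (n : ℕ) (x : A (n+2)), d n (d (n+1) x) = 0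
  comul : ∀ p q, A (p+q) →ₗ[R] (A p ⊗[R] A q)
  counit : A 0 →ₗ[R] R
  coaug : R →ₗ[R] A 0
  counit_coaug : counit (coaug 1) = 1
  coaug_grouplike : comul 0 0 (coaug 1) = coaug 1 ⊗ₜ[R] coaug 1
  comul_counit : ∀ (n : ℕ) (x : A n),
    TensorProduct.rid R (A n) ((TensorProduct.map LinearMap.id counit) (comul n 0 x)) = x
  counit_comul : ∀ (n : ℕ) (x : A n),
    TensorProduct.lid R (A n) ((TensorProduct.map counit LinearMap.id)
      (comul 0 n (pcast (R := R) (A := A) (Nat.zero_add n).symm x))) = x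
  coassoc : ∀ (p q r : ℕ) (x : A (p+q+r)),
    TensorProduct.assoc R (A p) (A q) (A r)
        ((TensorProduct.map (comul p q) LinearMap.id) (comul (p+q) r x))
      = (TensorProduct.map LinearMap.id (comul q r)) (comul p (q+r) (pcast (R := R) (A := A) (Nat.add_assoc p q r) x))
  coleib : ∀ (p q : ℕ) (x : A (p+q+1)),
    comul p q (d (p+q) x)
      = (TensorProduct.map (d p) LinearMap.id) (comul (p+1) q (pcast (R := R) (A := A) (by omega) x))
        + ((-1 : ℤ)^p) • (TensorProduct.map LinearMap.id (d q)) (comul p (q+1) (pcast (R := R) (A := A) (by omega) x))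
  counit_d : ∀ x : A 1, counit (d 0 x) = 0

section Setup

variable {R : Type} [CommRing R]
variable (A : ℕ → Type) [∀ n, AddCommGroup (A n)] [∀ n, Module R (A n)] (CA : CoalgStr R A)

/-- The reduced part `Ā` of a coaugmented chain coalgebra:
`ker ε` in degree 0, everything in positive degree. -/
def redT : ℕ → Type
  | 0 => ↥(LinearMap.ker CA.counit)
  | n+1 => A (n+1)

instance redT.acg : ∀ n, AddCommGroup (redT A CA n)
  | 0 => inferInstanceAs (AddCommGroup ↥(LinearMap.ker CA.counit))
  | n+1 => inferInstanceAs (AddCommGroup (A (n+1)))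

instance redT.mod : ∀ n, Module R (redT A CA n)
  | 0 => inferInstanceAs (Module R ↥(LinearMap.ker CA.counit))
  | n+1 => inferInstanceAs (Module R (A (n+1)))

/-- The total module of the reduced coalgebra `Ā`. -/
abbrev Big := ⨁ n, redT A CA n

/-- Reduction `A n → Ā n`: in degree 0 it kills the coaugmentation
(`x ↦ x - η(ε x)`), in positive degrees the identity. -/
def toRed : ∀ n, A n →ₗ[R] redT A CA n
  | 0 => LinearMap.codRestrict (LinearMap.ker CA.counit)
      (LinearMap.id - CA.coaug ∘ₗ CA.counit)
      (fun x => by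
        have h1 : CA.coaug (CA.counit x) = CA.counit x • CA.coaug 1 := by
          rw [← map_smul, smul_eq_mul, mul_one]
        simp only [LinearMap.mem_ker, LinearMap.sub_apply, LinearMap.id_apply,
          LinearMap.coe_comp, Function.comp_apply, map_sub, h1, map_smul,
          CA.counit_coaug, smul_eq_mul, mul_one, sub_self])
  | n+1 => LinearMap.id

/-- The embedding of a homogeneous component of `A` into `Ā`
(killing the coaugmentation in degree 0). -/
def embT (n : ℕ) : A n →ₗ[R] Big A CA :=
  (DirectSum.lof R ℕ (redT A CA) n).comp (toRed A CA n)

/-- The degree-0 "counit" of the component `A q` (the counit for `q = 0`, else `0`). -/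
def epsAt : ∀ q, A q →ₗ[R] R
  | 0 => CA.counit
  | _+1 => 0

/-- The value of the reduced diagonal `Δ̄` on a homogeneous element,
as an element of `Ā ⊗ Ā` (the embeddings kill the primitive terms). -/
def bigDiag (p : ℕ) : A p →ₗ[R] (Big A CA ⊗[R] Big A CA) :=
  ∑ j : Fin (p+1),
    (TensorProduct.map (embT A CA j.1) (embT A CA (p - j.1))).comp
      ((CA.comul j.1 (p - j.1)).comp (pcast (R := R) (A := A) (by have := j.is_le; omega)))

end Setup

section TwoCoalgebras

variable {R : Type} [CommRing R]
variable (A : ℕ → Type) [∀ n, AddCommGroup (A n)] [∀ n, Module R (A n)] (CA : CoalgStr R A)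
variable (B : ℕ → Type) [∀ n, AddCommGroup (B n)] [∀ n, Module R (B n)] (CB : CoalgStr R B)

/-- The module of generators of `Ω (A ⊗ B)`: the reduced part
`(A ⊗ B)‾ = (Ā ⊗ B̄) ⊕ Ā ⊕ B̄`. -/
abbrev WW := (Big A CA ⊗[R] Big B CB) × Big A CA × Big B CB

/-- The underlying algebra of the cobar construction `Ω (A ⊗ B)`. -/
abbrev Om := TensorAlgebra R (WW A CA B CB)

/-- The underlying algebra of `Ω A`. -/
abbrev OmA := TensorAlgebra R (Big A CA)

/-- The underlying algebra of `Ω B`. -/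
abbrev OmB := TensorAlgebra R (Big B CB)

/-- The letter `[a]`, `a ∈ Ā`. -/
def lA : Big A CA →ₗ[R] WW A CA B CB := LinearMap.prod 0 (LinearMap.prod LinearMap.id 0)

/-- The letter `[b]`, `b ∈ B̄`. -/
def lB : Big B CB →ₗ[R] WW A CA B CB := LinearMap.prod 0 (LinearMap.prod 0 LinearMap.id)

/-- The letter `[ab]`, `a ∈ Ā`, `b ∈ B̄`. -/
def lT : (Big A CA ⊗[R] Big B CB) →ₗ[R] WW A CA B CB := LinearMap.prod LinearMap.id 0

/-- The length-one word `[a]` in `Ω (A ⊗ B)`. -/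
def genA (x : Big A CA) : Om A CA B CB := TensorAlgebra.ι R (lA A CA B CB x)

/-- The length-one word `[b]` in `Ω (A ⊗ B)`. -/
def genB (y : Big B CB) : Om A CA B CB := TensorAlgebra.ι R (lB A CA B CB y)

/-- The length-one word `[ab]` in `Ω (A ⊗ B)`. -/
def genT (t : Big A CA ⊗[R] Big B CB) : Om A CA B CB := TensorAlgebra.ι R (lT A CA B CB t)

/-- The generator of `Ω(A⊗B)` corresponding to a homogeneous element of `A_p ⊗ B_q`
(decomposed into its `[āb̄]`, `[ā]`, `[b̄]` parts). -/
def Γg (p q : ℕ) : (A p ⊗[R] B q) →ₗ[R] WW A CA B CB :=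
  LinearMap.prod (TensorProduct.map (embT A CA p) (embT B CB q))
    (LinearMap.prod
      ((embT A CA p).comp ((TensorProduct.rid R (A p)).toLinearMap.comp
        (TensorProduct.map LinearMap.id (epsAt B CB q))))
      ((embT B CB q).comp ((TensorProduct.lid R (B q)).toLinearMap.comp
        (TensorProduct.map (epsAt A CA p) LinearMap.id))))

/-- The length-one word of `Ω (A ⊗ B)` on a homogeneous element of `A_p ⊗ B_q`. -/
def genW (p q : ℕ) (z : A p ⊗[R] B q) : Om A CA B CB :=
  TensorAlgebra.ι R (Γg A CA B CB p q z)

/-- The generator values of the Milgram map: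
`[a ⊗ 1] ↦ [a] ⊗ [ ]`, `[1 ⊗ b] ↦ [ ] ⊗ [b]`, `[a ⊗ b] ↦ 0`. -/
def qgen : WW A CA B CB →ₗ[R] (OmA A CA ⊗[R] OmB B CB) :=
  ((TensorProduct.mk R (OmA A CA) (OmB B CB)).flip 1).comp
      ((TensorAlgebra.ι R).comp
        ((LinearMap.fst R (Big A CA) (Big B CB)).comp
          (LinearMap.snd R (Big A CA ⊗[R] Big B CB) (Big A CA × Big B CB))))
  + (TensorProduct.mk R (OmA A CA) (OmB B CB) 1).comp
      ((TensorAlgebra.ι R).comp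
        ((LinearMap.snd R (Big A CA) (Big B CB)).comp
          (LinearMap.snd R (Big A CA ⊗[R] Big B CB) (Big A CA × Big B CB))))

/-- The Milgram map `q : Ω (A ⊗ B) → Ω A ⊗ Ω B`. -/
def qMil : Om A CA B CB →ₐ[R] (OmA A CA ⊗[R] OmB B CB) :=
  TensorAlgebra.lift R (qgen A CA B CB)

/-- `Ω i_A : Ω A → Ω (A ⊗ B)`. -/
def OiA : OmA A CA →ₐ[R] Om A CA B CB :=
  TensorAlgebra.lift R ((TensorAlgebra.ι R).comp (lA A CA B CB))

/-- `Ω i_B : Ω B → Ω (A ⊗ B)`. -/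
def OiB : OmB B CB →ₐ[R] Om A CA B CB :=
  TensorAlgebra.lift R ((TensorAlgebra.ι R).comp (lB A CA B CB))

/-- The natural section `σ : Ω A ⊗ Ω B → Ω (A ⊗ B)`,
`σ (u ⊗ v) = Ω i_A (u) · Ω i_B (v)`. -/
def sigmaMil : (OmA A CA ⊗[R] OmB B CB) →ₗ[R] Om A CA B CB :=
  TensorProduct.lift ((LinearMap.mul R (Om A CA B CB)).compl₁₂
    (OiA A CA B CB).toLinearMap (OiB A CA B CB).toLinearMap)

/-- Bilinear multiplication helper: `(m ⊗ n) ↦ f m * g n`. -/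
def mul2 {M N P : Type} [AddCommGroup M] [Module R M] [AddCommGroup N] [Module R N]
    [Ring P] [Algebra R P] (f : M →ₗ[R] P) (g : N →ₗ[R] P) : (M ⊗[R] N) →ₗ[R] P :=
  TensorProduct.lift ((LinearMap.mul R P).compl₁₂ f g)

/-- The word in `Ω (A ⊗ B)` given by a list of homogeneous letters from `Ā`. -/
def wordA (l : List ((p : ℕ) × A p)) : Om A CA B CB :=
  (l.map fun t => genA A CA B CB (embT A CA t.1 t.2)).prod

/-- The word in `Ω (A ⊗ B)` given by a list of homogeneous letters from `B̄`. -/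
def wordB (l : List ((q : ℕ) × B q)) : Om A CA B CB :=
  (l.map fun t => genB A CA B CB (embT B CB t.1 t.2)).prod

/-- The word in `Ω (A ⊗ B)` given by a list of general homogeneous letters. -/
def wordW (l : List ((pq : ℕ × ℕ) × (A pq.1 ⊗[R] B pq.2))) : Om A CA B CB :=
  (l.map fun t => genW A CA B CB t.1.1 t.1.2 t.2).prod

/-- Parity of the cobar degree of a word of `Ā`-letters. -/
def degA (l : List ((p : ℕ) × A p)) : ℕ := (l.map fun t => t.1).sum + l.length

/-- Parity of the cobar degree of a word of general letters. -/
def degW (l : List ((pq : ℕ × ℕ) × (A pq.1 ⊗[R] B pq.2))) : ℕ :=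
  (l.map fun t => t.1.1 + t.1.2).sum + l.length

/-- The Sweedler-type operation `(b₁ ⊗ b₂) ↦ h([b₁ | α]) · [a b₂]`. -/
def sweedC (h : Om A CA B CB →ₗ[R] Om A CA B CB) (α : List ((p : ℕ) × A p))
    (x : Big A CA) : (Big B CB ⊗[R] Big B CB) →ₗ[R] Om A CA B CB :=
  TensorProduct.lift ((LinearMap.mul R (Om A CA B CB)).compl₁₂
    (h ∘ₗ (LinearMap.mulRight R (wordA A CA B CB α)) ∘ₗ (TensorAlgebra.ι R) ∘ₗ lB A CA B CB)
    ((TensorAlgebra.ι R) ∘ₗ (lT A CA B CB) ∘ₗ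
      (TensorProduct.mk R (Big A CA) (Big B CB) x)))

/-- The Sweedler-type operation `(b₁ ⊗ b₂) ↦ [a b₁] · h([b₂ | α])`. -/
def sweedC2 (h : Om A CA B CB →ₗ[R] Om A CA B CB) (α : List ((p : ℕ) × A p))
    (x : Big A CA) : (Big B CB ⊗[R] Big B CB) →ₗ[R] Om A CA B CB :=
  TensorProduct.lift ((LinearMap.mul R (Om A CA B CB)).compl₁₂
    ((TensorAlgebra.ι R) ∘ₗ (lT A CA B CB) ∘ₗ
      (TensorProduct.mk R (Big A CA) (Big B CB) x))
    (h ∘ₗ (LinearMap.mulRight R (wordA A CA B CB α)) ∘ₗ (TensorAlgebra.ι R) ∘ₗ lB A CA B CB))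

end TwoCoalgebras

section CobarValues

variable {R : Type} [CommRing R]
variable (A : ℕ → Type) [∀ n, AddCommGroup (A n)] [∀ n, Module R (A n)] (CA : CoalgStr R A)

/-- The linear part `[dx]` of the cobar differential of `Ω A` on a generator. -/
def linAA : ∀ p, A p →ₗ[R] OmA A CA
  | 0 => 0
  | p+1 => (TensorAlgebra.ι R).comp ((embT A CA p).comp (CA.d p))

/-- The quadratic part `∑ (-1)^{deg x₍₁₎} [x₍₁₎|x₍₂₎]` of the cobar differential of
`Ω A` on a generator. -/
def quadAA (p : ℕ) : A p →ₗ[R] OmA A CA :=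
  ∑ j : Fin (p+1), ((-1 : ℤ)^(j.1)) •
    ((mul2 (TensorAlgebra.ι R) (TensorAlgebra.ι R)).comp
      ((TensorProduct.map (embT A CA j.1) (embT A CA (p - j.1))).comp
        ((CA.comul j.1 (p - j.1)).comp (pcast (R := R) (A := A) (by have := j.is_le; omega)))))

/-- The value of the cobar differential of `Ω A` on the generator given by a homogeneous
element: `d_Ω [x] = -[dx] + ∑ (-1)^{deg x₍₁₎} [x₍₁₎|x₍₂₎]`. -/
def dvalAA (p : ℕ) : A p →ₗ[R] OmA A CA := - linAA A CA p + quadAA A CA p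

/-- The word of `Ω A` given by a list of homogeneous letters. -/
def wordAlg (l : List ((p : ℕ) × A p)) : OmA A CA :=
  (l.map fun t => TensorAlgebra.ι R (embT A CA t.1 t.2)).prod

end CobarValues

section CobarValuesT

variable {R : Type} [CommRing R]
variable (A : ℕ → Type) [∀ n, AddCommGroup (A n)] [∀ n, Module R (A n)] (CA : CoalgStr R A)
variable (B : ℕ → Type) [∀ n, AddCommGroup (B n)] [∀ n, Module R (B n)] (CB : CoalgStr R B)

/-- `[(da) b]` : the `A`-part of the linear term of the cobar differential of
`Ω (A ⊗ B)` on a generator of bidegree `(p,q)`. -/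
def linT1 : ∀ (p q : ℕ), (A p ⊗[R] B q) →ₗ[R] Om A CA B CB
  | 0, _ => 0
  | p+1, q => ((TensorAlgebra.ι R).comp (Γg A CA B CB p q)).comp
      (TensorProduct.map (CA.d p) LinearMap.id)

/-- `(-1)^p [a (db)]` : the `B`-part of the linear term. -/
def linT2 : ∀ (p q : ℕ), (A p ⊗[R] B q) →ₗ[R] Om A CA B CB
  | _, 0 => 0
  | p, q+1 => ((-1 : ℤ)^p) • (((TensorAlgebra.ι R).comp (Γg A CA B CB p q)).comp
      (TensorProduct.map LinearMap.id (CB.d q)))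

/-- The quadratic (Künneth) part of the cobar differential of `Ω (A ⊗ B)` on a
generator of bidegree `(p,q)`:
`∑ (-1)^{q₁p₂} (-1)^{p₁+q₁} [a₍₁₎b₍₁₎ | a₍₂₎b₍₂₎]` (primitive terms being killed by
the reduction embeddings). -/
def quadT (p q : ℕ) : (A p ⊗[R] B q) →ₗ[R] Om A CA B CB :=
  ∑ j : Fin (p+1), ∑ k : Fin (q+1),
    ((-1 : ℤ)^(k.1 * (p - j.1) + j.1 + k.1)) •
      ((mul2 ((TensorAlgebra.ι R).comp (Γg A CA B CB j.1 k.1))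
             ((TensorAlgebra.ι R).comp (Γg A CA B CB (p - j.1) (q - k.1)))).comp
        ((TensorProduct.tensorTensorTensorComm R (A j.1) (A (p - j.1)) (B k.1) (B (q - k.1))).toLinearMap.comp
          (TensorProduct.map
            ((CA.comul j.1 (p - j.1)).comp (pcast (R := R) (A := A) (by have := j.is_le; omega)))
            ((CB.comul k.1 (q - k.1)).comp (pcast (R := R) (A := B) (by have := k.is_le; omega))))))

/-- The value of the cobar differential of `Ω (A ⊗ B)` on the generator given by a
homogeneous element of `A_p ⊗ B_q`:
`d_Ω [w] = -[d_{A⊗B} w] + ∑ (-1)^{deg w₍₁₎} [w₍₁₎ | w₍₂₎]`. -/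
def dvalT (p q : ℕ) : (A p ⊗[R] B q) →ₗ[R] Om A CA B CB :=
  - linT1 A CA B CB p q - linT2 A CA B CB p q + quadT A CA B CB p q

end CobarValuesT

section Grading

variable {R : Type} [CommRing R]
variable {A : ℕ → Type} [∀ n, AddCommGroup (A n)] [∀ n, Module R (A n)]

@[simp] theorem pcast_rfl {n : ℕ} (h : n = n) (x : A n) : pcast (R := R) (A := A) h x = x := rfl

@[simp] theorem pcast_pcast {l m n : ℕ} (h : l = m) (h' : m = n) (x : A l) :
    pcast (R := R) (A := A) h' (pcast (R := R) (A := A) h x)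
      = pcast (R := R) (A := A) (h.trans h') x := by
  subst h h'; rfl

variable (CA : CoalgStr R A) {M : Type} [AddCommGroup M] [Module R M]

/-- The contribution of the `(i, k)` component of the diagonal to a sum over the diagonal. -/
def diagTerm (F : ∀ i k, (A i ⊗[R] A k) →ₗ[R] M) (p i k : ℕ) (x : A p) : M :=
  if h : p = i + k then F i k (CA.comul i k (pcast (R := R) (A := A) h x)) else 0

theorem diagTerm_of_eq (F : ∀ i k, (A i ⊗[R] A k) →ₗ[R] M) {p i k : ℕ} (h : p = i + k)
    (x : A p) :
    diagTerm CA F p i k x = F i k (CA.comul i k (pcast (R := R) (A := A) h x)) :=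
  dif_pos h

/-- The sum over the components of the diagonal of a family of linear maps. -/
def diagSum (F : ∀ i k, (A i ⊗[R] A k) →ₗ[R] M) (p : ℕ) : A p →ₗ[R] M :=
  ∑ j : Fin (p+1), (F j.1 (p - j.1)).comp
    ((CA.comul j.1 (p - j.1)).comp (pcast (R := R) (A := A) (by have := j.is_le; omega)))

theorem diagSum_apply (F : ∀ i k, (A i ⊗[R] A k) →ₗ[R] M) (p : ℕ) (x : A p) :
    diagSum CA F p x
      = ∑ ik ∈ Finset.HasAntidiagonal.antidiagonal p, diagTerm CA F p ik.1 ik.2 x := by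
  rw [Finset.Nat.sum_antidiagonal_eq_sum_range_succ (fun i k => diagTerm CA F p i k x),
    Finset.sum_range, diagSum, LinearMap.sum_apply]
  refine Finset.sum_congr rfl fun j _ => ?_
  rw [diagTerm_of_eq CA F (by have := j.is_le; omega)]
  rfl

theorem bigDiag_eq_diagSum (p : ℕ) :
    bigDiag A CA p
      = diagSum CA (fun i k => TensorProduct.map (embT A CA i) (embT A CA k)) p := rfl

theorem sum_antidiagonal_assoc {N : Type*} [AddCommMonoid N] (f : ℕ → ℕ → ℕ → N) (p : ℕ) :
    ∑ mk ∈ Finset.HasAntidiagonal.antidiagonal p,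
        ∑ ij ∈ Finset.HasAntidiagonal.antidiagonal mk.1, f ij.1 ij.2 mk.2
      = ∑ im ∈ Finset.HasAntidiagonal.antidiagonal p,
        ∑ jk ∈ Finset.HasAntidiagonal.antidiagonal im.2, f im.1 jk.1 jk.2 := by
  rw [Finset.sum_sigma', Finset.sum_sigma']
  refine Finset.sum_bij' (fun a _ => ⟨(a.2.1, a.2.2 + a.1.2), (a.2.2, a.1.2)⟩)
    (fun a _ => ⟨(a.1.1 + a.2.1, a.2.2), (a.1.1, a.2.1)⟩) ?_ ?_ ?_ ?_ ?_
  all_goals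
    rintro ⟨⟨a, b⟩, ⟨c, d⟩⟩ h
    simp only [Finset.mem_sigma, Finset.HasAntidiagonal.mem_antidiagonal] at h
    obtain ⟨rfl, rfl⟩ := h
  · simp [Nat.add_assoc]
  · simp [Nat.add_assoc]
  all_goals rfl

theorem embT_surjective_lof (n : ℕ) (x : redT A CA n) :
    ∃ y : A n, embT A CA n y = DirectSum.lof R ℕ (redT A CA) n x := by
  cases n with
  | zero =>
    obtain ⟨y, hy⟩ := x
    refine ⟨y, congrArg (DirectSum.lof R ℕ (redT A CA) 0) (Subtype.ext ?_)⟩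
    change y - CA.coaug (CA.counit y) = y
    rw [LinearMap.mem_ker.mp hy, map_zero, sub_zero]
  | succ n => exact ⟨x, rfl⟩

theorem big_induction {P : Big A CA → Prop} (v : Big A CA)
    (zero : P 0) (emb : ∀ n (x : A n), P (embT A CA n x))
    (add : ∀ v w, P v → P w → P (v + w)) : P v := by
  induction v using DirectSum.induction_on with
  | zero => exact zero
  | of n x =>
    obtain ⟨y, hy⟩ := embT_surjective_lof CA n x
    exact hy ▸ emb n y
  | add v w hv hw => exact add v w hv hw

theorem embT_coaug (r : R) : embT A CA 0 (CA.coaug r) = 0 := by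
  have h : toRed A CA 0 (CA.coaug r) = 0 := by
    refine Subtype.ext ?_
    change CA.coaug r - CA.coaug (CA.counit (CA.coaug r)) = 0
    have h1 : CA.coaug r = r • CA.coaug 1 := by rw [← map_smul, smul_eq_mul, mul_one]
    rw [h1, map_smul, CA.counit_coaug, smul_eq_mul, mul_one, h1, sub_self]
  rw [embT, LinearMap.comp_apply, h, map_zero]

theorem bigDiag_coaug (r : R) : bigDiag A CA 0 (CA.coaug r) = 0 := by
  have h1 : CA.coaug r = r • CA.coaug 1 := by rw [← map_smul, smul_eq_mul, mul_one]
  rw [bigDiag_eq_diagSum, diagSum_apply, Finset.Nat.antidiagonal_zero, Finset.sum_singleton,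
    diagTerm_of_eq CA _ (p := 0) (i := 0) (k := 0) rfl, h1, map_smul, map_smul, pcast_rfl,
    CA.coaug_grouplike, map_smul,
    TensorProduct.map_tmul, embT_coaug, TensorProduct.zero_tmul, smul_zero]

/-- The inclusion of the reduced part in each degree. -/
def inclRed : ∀ n, redT A CA n →ₗ[R] A n
  | 0 => (LinearMap.ker CA.counit).subtype
  | _+1 => LinearMap.id

/-- The reduced diagonal of `Ā`. -/
def redDiag : Big A CA →ₗ[R] (Big A CA ⊗[R] Big A CA) :=
  DirectSum.toModule R ℕ _ fun n => (bigDiag A CA n).comp (inclRed CA n)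

theorem redDiag_embT (n : ℕ) (x : A n) : redDiag CA (embT A CA n x) = bigDiag A CA n x := by
  rw [redDiag, embT, LinearMap.comp_apply, DirectSum.toModule_lof, LinearMap.comp_apply]
  cases n with
  | zero =>
    change bigDiag A CA 0 (x - CA.coaug (CA.counit x)) = _
    rw [map_sub, bigDiag_coaug, sub_zero]
  | succ n => rfl

/-- The differential of `A` followed by the embedding into `Ā`. -/
def embD : ∀ n, A n →ₗ[R] Big A CA
  | 0 => 0
  | n+1 => (embT A CA n).comp (CA.d n)

/-- The differential of `Ā`. -/
def redD : Big A CA →ₗ[R] Big A CA :=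
  DirectSum.toModule R ℕ _ fun n => (embD CA n).comp (inclRed CA n)

theorem redD_embT (n : ℕ) (x : A n) : redD CA (embT A CA n x) = embD CA n x := by
  rw [redD, embT, LinearMap.comp_apply, DirectSum.toModule_lof, LinearMap.comp_apply]
  cases n <;> rfl

theorem redD_comp_embT (n : ℕ) : redD CA ∘ₗ embT A CA n = embD CA n :=
  LinearMap.ext fun x => redD_embT CA n x

theorem map_diagTerm {N : Type} [AddCommGroup N] [Module R N] (g : M →ₗ[R] N)
    (F : ∀ i k, (A i ⊗[R] A k) →ₗ[R] M) (p i k : ℕ) (x : A p) :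
    g (diagTerm CA F p i k x) = diagTerm CA (fun i k => g ∘ₗ F i k) p i k x := by
  unfold diagTerm
  split_ifs <;> simp

theorem map_diagSum {N : Type} [AddCommGroup N] [Module R N] (g : M →ₗ[R] N)
    (F : ∀ i k, (A i ⊗[R] A k) →ₗ[R] M) (p : ℕ) (x : A p) :
    g (diagSum CA F p x) = diagSum CA (fun i k => g ∘ₗ F i k) p x := by
  simp only [diagSum_apply, map_sum, map_diagTerm]

/-- The iterated diagonal term obtained by expanding the left factor. -/
theorem diagTerm_expand_left (G : ∀ i j k, ((A i ⊗[R] A j) ⊗[R] A k) →ₗ[R] M)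
    (p m k : ℕ) (hp : p = m + k) (x : A p)
    (F : ∀ m k, (A m ⊗[R] A k) →ₗ[R] M)
    (hF : ∀ m k (u : A m) (v : A k), F m k (u ⊗ₜ v)
      = diagSum CA (fun i j => G i j k ∘ₗ (TensorProduct.mk R _ _).flip v) m u) :
    diagTerm CA F p m k x = ∑ ij ∈ Finset.HasAntidiagonal.antidiagonal m,
      if h : p = ij.1 + ij.2 + k then G ij.1 ij.2 k
        (TensorProduct.map (CA.comul ij.1 ij.2) LinearMap.id
          (CA.comul (ij.1 + ij.2) k (pcast (R := R) (A := A) h x))) else 0 := by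
  subst hp
  rw [diagTerm_of_eq CA F rfl, pcast_rfl]
  have key : ∀ z : A m ⊗[R] A k, F m k z = ∑ ij ∈ Finset.HasAntidiagonal.antidiagonal m,
      if h : m = ij.1 + ij.2 then G ij.1 ij.2 k
        (TensorProduct.map (CA.comul ij.1 ij.2 ∘ₗ pcast (R := R) (A := A) h) LinearMap.id z)
      else 0 := by
    intro z
    induction z with
    | zero => simp
    | add z w hz hw =>
      rw [map_add, hz, hw, ← Finset.sum_add_distrib]
      refine Finset.sum_congr rfl fun ij _ => ?_
      split_ifs <;> simp
    | tmul u v =>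
      rw [hF, diagSum_apply]
      refine Finset.sum_congr rfl fun ij _ => ?_
      unfold diagTerm
      split_ifs <;> rfl
  rw [key]
  refine Finset.sum_congr rfl fun ij hij => ?_
  obtain ⟨i, j⟩ := ij
  obtain rfl : i + j = m := Finset.HasAntidiagonal.mem_antidiagonal.mp hij
  rw [dif_pos rfl, dif_pos rfl]
  rfl

theorem diagTerm_expand_right (G : ∀ i j k, (A i ⊗[R] (A j ⊗[R] A k)) →ₗ[R] M)
    (p i m : ℕ) (hp : p = i + m) (x : A p)
    (F : ∀ i m, (A i ⊗[R] A m) →ₗ[R] M)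
    (hF : ∀ i m (u : A i) (v : A m), F i m (u ⊗ₜ v)
      = diagSum CA (fun j k => G i j k ∘ₗ TensorProduct.mk R _ _ u) m v) :
    diagTerm CA F p i m x = ∑ jk ∈ Finset.HasAntidiagonal.antidiagonal m,
      if h : p = i + (jk.1 + jk.2) then G i jk.1 jk.2
        (TensorProduct.map LinearMap.id (CA.comul jk.1 jk.2)
          (CA.comul i (jk.1 + jk.2) (pcast (R := R) (A := A) h x))) else 0 := by
  subst hp
  rw [diagTerm_of_eq CA F rfl, pcast_rfl]
  have key : ∀ z : A i ⊗[R] A m, F i m z = ∑ jk ∈ Finset.HasAntidiagonal.antidiagonal m,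
      if h : m = jk.1 + jk.2 then G i jk.1 jk.2
        (TensorProduct.map LinearMap.id (CA.comul jk.1 jk.2 ∘ₗ pcast (R := R) (A := A) h) z)
      else 0 := by
    intro z
    induction z with
    | zero => simp
    | add z w hz hw =>
      rw [map_add, hz, hw, ← Finset.sum_add_distrib]
      refine Finset.sum_congr rfl fun ij _ => ?_
      split_ifs <;> simp
    | tmul u v =>
      rw [hF, diagSum_apply]
      refine Finset.sum_congr rfl fun ij _ => ?_
      unfold diagTerm
      split_ifs <;> rfl
  rw [key]
  refine Finset.sum_congr rfl fun jk hjk => ?_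
  obtain ⟨j, k⟩ := jk
  obtain rfl : j + k = m := Finset.HasAntidiagonal.mem_antidiagonal.mp hjk
  rw [dif_pos rfl, dif_pos rfl]
  rfl

/-- Coassociativity of the reduced diagonal. -/
theorem redDiag_coassoc (v : Big A CA) :
    TensorProduct.assoc R _ _ _ (TensorProduct.map (redDiag CA) LinearMap.id (redDiag CA v))
      = TensorProduct.map LinearMap.id (redDiag CA) (redDiag CA v) := by
  induction v using big_induction CA with
  | zero => simp
  | add v w hv hw => simp only [map_add, hv, hw]
  | emb p x =>
    rw [redDiag_embT, bigDiag_eq_diagSum, map_diagSum]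
    have hl := map_diagSum CA ((TensorProduct.assoc R _ _ _).toLinearMap ∘ₗ
      TensorProduct.map (redDiag CA) LinearMap.id)
      (fun i k => TensorProduct.map (embT A CA i) (embT A CA k)) p x
    refine hl.trans ?_
    rw [diagSum_apply, diagSum_apply]
    let e := fun n => embT A CA n
    rw [Finset.sum_congr rfl fun mk hmk => diagTerm_expand_left CA
        (fun i j k => TensorProduct.map (e i) (TensorProduct.map (e j) (e k)) ∘ₗ
          (TensorProduct.assoc R (A i) (A j) (A k)).toLinearMap)
        p mk.1 mk.2 (Finset.HasAntidiagonal.mem_antidiagonal.mp hmk).symm x _ ?_,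
      Finset.sum_congr rfl fun im him => diagTerm_expand_right CA
        (fun i j k => TensorProduct.map (e i) (TensorProduct.map (e j) (e k)))
        p im.1 im.2 (Finset.HasAntidiagonal.mem_antidiagonal.mp him).symm x _ ?_]
    · refine (sum_antidiagonal_assoc (fun i j k => if h : p = i + j + k then
          (TensorProduct.map (e i) (TensorProduct.map (e j) (e k)) ∘ₗ
            (TensorProduct.assoc R (A i) (A j) (A k)).toLinearMap)
            (TensorProduct.map (CA.comul i j) LinearMap.id
              (CA.comul (i + j) k (pcast (R := R) (A := A) h x))) else 0) p).trans ?_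
      refine Finset.sum_congr rfl fun im _ => Finset.sum_congr rfl fun jk _ => ?_
      by_cases h : p = im.1 + jk.1 + jk.2
      · rw [dif_pos h, dif_pos (h.trans (Nat.add_assoc _ _ _)), LinearMap.comp_apply,
          LinearEquiv.coe_coe, CA.coassoc, pcast_pcast]
      · rw [dif_neg h, dif_neg (by rwa [← Nat.add_assoc])]
    · intro i m u v
      simp only [LinearMap.comp_apply, TensorProduct.map_tmul, LinearMap.id_apply, redDiag_embT,
        bigDiag_eq_diagSum]
      change (TensorProduct.mk R _ _ (embT A CA i u)) _ = _
      rw [map_diagSum]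
      congr 2
    · intro m k u v
      simp only [LinearMap.comp_apply, TensorProduct.map_tmul, LinearMap.id_apply, redDiag_embT,
        bigDiag_eq_diagSum]
      change ((TensorProduct.assoc R _ _ _).toLinearMap ∘ₗ
        (TensorProduct.mk R _ _).flip (embT A CA k v)) _ = _
      rw [map_diagSum]
      refine LinearMap.congr_fun (congrArg (fun F => diagSum CA F m) ?_) u
      funext i j
      ext a b
      rfl

theorem neg_one_pow_zsmul [CharP R 2] (n : ℕ) (x : M) : ((-1 : ℤ)^n) • x = x := by
  have h : -x = x := by
    rw [← neg_one_smul R, CharTwo.neg_eq, one_smul]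
  rcases neg_one_pow_eq_or ℤ n with h1 | h1 <;> simp [h1, h]

/-- The co-Leibniz rule for the reduced diagonal in characteristic `2`. -/
theorem redDiag_redD [CharP R 2] (v : Big A CA) :
    redDiag CA (redD CA v)
      = TensorProduct.map (redD CA) LinearMap.id (redDiag CA v)
        + TensorProduct.map LinearMap.id (redD CA) (redDiag CA v) := by
  induction v using big_induction CA with
  | zero => simp
  | add v w hv hw => simp only [map_add, hv, hw]; abel
  | emb p x =>
    rw [redDiag_embT, redD_embT, bigDiag_eq_diagSum, map_diagSum, map_diagSum]
    simp only [← TensorProduct.map_comp, redD_comp_embT, LinearMap.id_comp]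
    cases p with
    | zero => simp [embD, diagSum_apply, diagTerm]
    | succ p =>
      rw [embD, LinearMap.comp_apply, redDiag_embT, bigDiag_eq_diagSum]
      simp only [diagSum_apply]
      rw [Finset.Nat.sum_antidiagonal_succ, Finset.Nat.sum_antidiagonal_succ',
        diagTerm_of_eq _ _ (by simp), diagTerm_of_eq _ _ (by simp)]
      simp only [embD, TensorProduct.map_zero_left, TensorProduct.map_zero_right,
        LinearMap.zero_apply, zero_add]
      rw [← Finset.sum_add_distrib]
      refine Finset.sum_congr rfl fun ik hik => ?_
      obtain ⟨i, k⟩ := ik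
      obtain rfl : i + k = p := Finset.HasAntidiagonal.mem_antidiagonal.mp hik
      rw [diagTerm_of_eq _ _ rfl, diagTerm_of_eq _ _ (by omega), diagTerm_of_eq _ _ (by omega),
        pcast_rfl, CA.coleib, neg_one_pow_zsmul (R := R), map_add]
      rw [TensorProduct.map_map, TensorProduct.map_map, LinearMap.comp_id, LinearMap.comp_id]

theorem diagSum_rid (F : ∀ i, A i →ₗ[R] M) (p : ℕ) (x : A p) :
    diagSum CA (fun i k => (F i).comp ((TensorProduct.rid R (A i)).toLinearMap.comp
      (TensorProduct.map LinearMap.id (epsAt A CA k)))) p x = F p x := by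
  rw [diagSum_apply, Finset.sum_eq_single (p, 0), diagTerm_of_eq _ _ (Nat.add_zero p).symm]
  · exact congrArg (F p) (CA.comul_counit p x)
  · rintro ⟨i, k⟩ hik hne
    cases k with
    | zero => exact absurd (by simpa using hik) (by simpa using hne)
    | succ k => simp [diagTerm, epsAt]
  · simp

theorem diagSum_lid (F : ∀ i, A i →ₗ[R] M) (p : ℕ) (x : A p) :
    diagSum CA (fun i k => (F k).comp ((TensorProduct.lid R (A k)).toLinearMap.comp
      (TensorProduct.map (epsAt A CA i) LinearMap.id))) p x = F p x := by
  rw [diagSum_apply, Finset.sum_eq_single (0, p), diagTerm_of_eq _ _ (Nat.zero_add p).symm]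
  · exact congrArg (F p) (CA.counit_comul p x)
  · rintro ⟨i, k⟩ hik hne
    cases i with
    | zero => exact absurd (by simpa using hik) (by simpa using hne)
    | succ k => simp [diagTerm, epsAt]
  · simp

end Grading
section Convolution

variable {R U W Ω : Type} [CommRing R] [AddCommGroup U] [Module R U] [AddCommGroup W] [Module R W]
variable [Ring Ω] [Algebra R Ω]

@[simp] theorem mul2_tmul (f : U →ₗ[R] Ω) (g : W →ₗ[R] Ω) (u : U) (w : W) :
    mul2 f g (u ⊗ₜ w) = f u * g w := rfl

/-- The convolution product of linear maps out of `U` with respect to a diagonal of `U`. -/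
def conv (Δ : U →ₗ[R] U ⊗[R] U) :
    (U →ₗ[R] Ω) →ₗ[R] (U →ₗ[R] Ω) →ₗ[R] (U →ₗ[R] Ω) :=
  LinearMap.mk₂ R (fun f g => mul2 f g ∘ₗ Δ)
    (fun f f' g => by rw [← LinearMap.add_comp]; congr 1; ext; simp [add_mul])
    (fun c f g => by rw [← LinearMap.smul_comp]; congr 1; ext; simp)
    (fun f g g' => by rw [← LinearMap.add_comp]; congr 1; ext; simp [mul_add])
    (fun c f g => by rw [← LinearMap.smul_comp]; congr 1; ext; simp)

variable (Δ : U →ₗ[R] U ⊗[R] U) (f g k : U →ₗ[R] Ω) (ω : Ω)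

theorem conv_eq : conv Δ f g = mul2 f g ∘ₗ Δ := rfl

theorem conv_apply (u : U) : conv Δ f g u = mul2 f g (Δ u) := rfl

theorem conv_smul_left : conv Δ (ω • f) g = ω • conv Δ f g := by
  rw [conv_eq, conv_eq, ← LinearMap.smul_comp]
  congr 1; ext; simp [mul_assoc]

theorem conv_op_smul_right :
    conv Δ f (MulOpposite.op ω • g) = MulOpposite.op ω • conv Δ f g := by
  rw [conv_eq, conv_eq, ← LinearMap.smul_comp]
  congr 1; ext; simp [mul_assoc]

theorem conv_op_smul_left : conv Δ (MulOpposite.op ω • f) g = conv Δ f (ω • g) := by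
  rw [conv_eq, conv_eq]
  congr 1; ext; simp [mul_assoc]

theorem op_smul_smul (ω' : Ω) :
    MulOpposite.op ω • ω' • f = ω' • MulOpposite.op ω • f := by
  ext; simp [mul_assoc]

theorem conv_assoc
    (hΔ : ∀ u, TensorProduct.assoc R _ _ _ (TensorProduct.map Δ LinearMap.id (Δ u))
      = TensorProduct.map LinearMap.id Δ (Δ u)) :
    conv Δ (conv Δ f g) k = conv Δ f (conv Δ g k) := by
  have h1 : conv Δ (conv Δ f g) k
      = (mul2 (mul2 f g) k) ∘ₗ (TensorProduct.map Δ LinearMap.id ∘ₗ Δ) := by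
    rw [← LinearMap.comp_assoc, conv_eq]; congr 1; ext; rfl
  have h2 : conv Δ f (conv Δ g k)
      = (mul2 f (mul2 g k)) ∘ₗ (TensorProduct.map LinearMap.id Δ ∘ₗ Δ) := by
    rw [← LinearMap.comp_assoc, conv_eq]; congr 1; ext; rfl
  have h3 : mul2 (mul2 f g) k
      = mul2 f (mul2 g k) ∘ₗ (TensorProduct.assoc R U U U).toLinearMap := by
    ext; simp [mul_assoc]
  rw [h1, h2, h3]
  ext u
  simp only [LinearMap.comp_apply, LinearEquiv.coe_coe, hΔ]

theorem comp_conv (D : Ω →ₗ[R] Ω) (hD : ∀ x y, D (x * y) = D x * y + x * D y) :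
    D ∘ₗ conv Δ f g = conv Δ (D ∘ₗ f) g + conv Δ f (D ∘ₗ g) := by
  simp only [conv_eq]
  rw [← LinearMap.add_comp, ← LinearMap.comp_assoc]
  congr 1; ext; simp [hD]

theorem conv_comp (d : U →ₗ[R] U)
    (hd : ∀ u, Δ (d u) = TensorProduct.map d LinearMap.id (Δ u)
      + TensorProduct.map LinearMap.id d (Δ u)) :
    conv Δ f g ∘ₗ d = conv Δ (f ∘ₗ d) g + conv Δ f (g ∘ₗ d) := by
  have h1 : mul2 (f ∘ₗ d) g = mul2 f g ∘ₗ TensorProduct.map d LinearMap.id := by ext; rfl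
  have h2 : mul2 f (g ∘ₗ d) = mul2 f g ∘ₗ TensorProduct.map LinearMap.id d := by ext; rfl
  ext u
  simp [conv_apply, h1, h2, hd]

theorem comp_smul_left (D : Ω →ₗ[R] Ω) (hD : ∀ x y, D (x * y) = D x * y + x * D y) :
    D ∘ₗ (ω • f) = D ω • f + ω • (D ∘ₗ f) := by
  ext; simp [hD]

theorem comp_op_smul (D : Ω →ₗ[R] Ω) (hD : ∀ x y, D (x * y) = D x * y + x * D y) :
    D ∘ₗ (MulOpposite.op ω • f)
      = MulOpposite.op (D ω) • f + MulOpposite.op ω • (D ∘ₗ f) := by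
  ext; simp [hD, add_comm]

theorem mul_right_formula_of_mem_span (H : Ω →ₗ[R] U →ₗ[R] Ω) (X : Set Ω) (a : Ω)
    (hX : ∀ α ∈ X, H (α * a) = α • f + MulOpposite.op a • H α + conv Δ (H α) f)
    {α : Ω} (hα : α ∈ Submodule.span R X) :
    H (α * a) = α • f + MulOpposite.op a • H α + conv Δ (H α) f := by
  induction hα using Submodule.span_induction with
  | mem α hα => exact hX α hα
  | zero => simp
  | add α β _ _ hα hβ =>
    rw [add_mul, map_add, hα, hβ, map_add, map_add, LinearMap.add_apply, add_smul, smul_add]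
    abel
  | smul c α _ hα =>
    rw [smul_mul_assoc, map_smul, hα, map_smul, map_smul, LinearMap.smul_apply, smul_add,
      smul_add, smul_assoc, smul_comm c (MulOpposite.op a)]

/-- The inductive step of the homotopy formula, written in the convolution algebra of linear
maps `U → Ω`: `H α` is `b ↦ h [b | α]`, `T a` is `b ↦ [ab]` and `J` is `b ↦ [b]`. -/
theorem homotopy_formula_step {V ι : Type} [AddCommGroup V] [Module R V] [CharP R 2]
    (hΔ : ∀ u, TensorProduct.assoc R _ _ _ (TensorProduct.map Δ LinearMap.id (Δ u))
      = TensorProduct.map LinearMap.id Δ (Δ u))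
    (d : U →ₗ[R] U)
    (hd : ∀ u, Δ (d u) = TensorProduct.map d LinearMap.id (Δ u)
      + TensorProduct.map LinearMap.id d (Δ u))
    (D : Ω →ₗ[R] Ω) (hD : ∀ x y, D (x * y) = D x * y + x * D y)
    (J : U →ₗ[R] Ω) (T : V →ₗ[R] U →ₗ[R] Ω) (A : V →ₗ[R] Ω) (H : Ω →ₗ[R] U →ₗ[R] Ω)
    (S : Submodule R Ω) (hS : ∀ α ∈ S, ∀ v, α * A v ∈ S)
    (hH : ∀ α ∈ S, ∀ v, H (α * A v)
      = α • T v + MulOpposite.op (A v) • H α + conv Δ (H α) (T v))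
    (α : Ω) (hα : α ∈ S) (hDα : D α ∈ S) (x x' : V) (s : Finset ι) (p q : ι → V)
    (hDA : D (A x) = A x' + ∑ i ∈ s, A (p i) * A (q i))
    (hDT : ∀ u, D (T x u) = T x' u + T x (d u) + A x * J u + J u * A x
      + mul2 (T x) J (Δ u) + mul2 J (T x) (Δ u)
      + ∑ i ∈ s, (T (p i) u * A (q i) + A (p i) * T (q i) u + mul2 (T (p i)) (T (q i)) (Δ u)))
    (ih : D ∘ₗ H α = H α ∘ₗ d + conv Δ J (H α) + conv Δ (H α) J + H (D α)
      + α • J + MulOpposite.op α • J) :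
    D ∘ₗ H (α * A x) = H (α * A x) ∘ₗ d + conv Δ J (H (α * A x)) + conv Δ (H (α * A x)) J
      + H (D (α * A x)) + (α * A x) • J + MulOpposite.op (α * A x) • J := by
  have h2 : ∀ i, H (α * (A (p i) * A (q i))) = (α * A (p i)) • T (q i)
      + MulOpposite.op (A (q i)) • H (α * A (p i)) + conv Δ (H (α * A (p i))) (T (q i)) := by
    intro i
    rw [← mul_assoc, hH _ (hS α hα _)]
  have h_two : ∀ f : U →ₗ[R] Ω, (2 : ℤ) • f = 0 := by
    intro f
    rw [two_smul, ← two_smul R, CharTwo.two_eq_zero, zero_smul]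
  have hDT' : D ∘ₗ T x = T x' + T x ∘ₗ d + A x • J + MulOpposite.op (A x) • J
      + conv Δ (T x) J + conv Δ J (T x)
      + ∑ i ∈ s, (MulOpposite.op (A (q i)) • T (p i) + A (p i) • T (q i)
        + conv Δ (T (p i)) (T (q i))) := by
    ext u
    simp [hDT, conv_apply]
  rw [hD, map_add, hH _ hDα, hDA, mul_add, map_add, hH α hα x', Finset.mul_sum, map_sum,
    Finset.sum_congr rfl fun i _ => h2 i]
  simp only [hH α hα, LinearMap.comp_add, comp_smul_left _ _ D hD, comp_op_smul _ _ D hD,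
    comp_conv _ _ _ D hD, ih, hDT', hDA]
  simp only [LinearMap.add_comp, LinearMap.smul_comp, conv_comp Δ _ _ d hd, map_add,
    LinearMap.add_apply, smul_add, add_smul, MulOpposite.op_add, MulOpposite.op_mul, mul_smul,
    Finset.smul_sum, Finset.sum_smul, Finset.op_sum, map_sum, Finset.sum_add_distrib,
    conv_smul_left, conv_op_smul_right, conv_op_smul_left, op_smul_smul, conv_assoc Δ _ _ _ hΔ]
  abel_nf
  simp only [h_two, zero_add]

end Convolution
section Generators

variable {R : Type} [CommRing R]
variable {A : ℕ → Type} [∀ n, AddCommGroup (A n)] [∀ n, Module R (A n)] (CA : CoalgStr R A)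
variable {B : ℕ → Type} [∀ n, AddCommGroup (B n)] [∀ n, Module R (B n)] (CB : CoalgStr R B)

/-- The letter `[a]` as a linear map. -/
def genAL : Big A CA →ₗ[R] Om A CA B CB := TensorAlgebra.ι R ∘ₗ lA A CA B CB

/-- The letter `[b]` as a linear map. -/
def genBL : Big B CB →ₗ[R] Om A CA B CB := TensorAlgebra.ι R ∘ₗ lB A CA B CB

/-- The letter `[ab]` as a linear map out of the tensor product. -/
def genTL : Big A CA ⊗[R] Big B CB →ₗ[R] Om A CA B CB := TensorAlgebra.ι R ∘ₗ lT A CA B CB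

/-- The letter `[ab]` as a bilinear map. -/
def genTB : Big A CA →ₗ[R] Big B CB →ₗ[R] Om A CA B CB :=
  (TensorProduct.mk R _ _).compr₂ (genTL CA CB)

theorem genTL_tmul (v : Big A CA) (u : Big B CB) :
    genTL CA CB (v ⊗ₜ u) = genTB CA CB v u := rfl

theorem genW_tmul (p q : ℕ) (x : A p) (y : B q) :
    genW A CA B CB p q (x ⊗ₜ y)
      = genTB CA CB (embT A CA p x) (embT B CB q y)
        + epsAt B CB q y • genAL CA CB (embT A CA p x)
        + epsAt A CA p x • genBL CA CB (embT B CB q y) := by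
  have h : Γg A CA B CB p q (x ⊗ₜ y)
      = lT A CA B CB (embT A CA p x ⊗ₜ embT B CB q y)
        + epsAt B CB q y • lA A CA B CB (embT A CA p x)
        + epsAt A CA p x • lB A CA B CB (embT B CB q y) := by
    simp [Γg, lT, lA, lB]
  rw [genW, h]
  simp only [map_add, map_smul]
  rfl

/-- The components of a two-fold tensor seen by the quadratic part of the differential. -/
def tensorParts (i k : ℕ) : (A i ⊗[R] A k) →ₗ[R]
    (Big A CA ⊗[R] Big A CA) × Big A CA × Big A CA × R :=
  LinearMap.prod (TensorProduct.map (embT A CA i) (embT A CA k))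
    (LinearMap.prod
      ((embT A CA i).comp ((TensorProduct.rid R (A i)).toLinearMap.comp
        (TensorProduct.map LinearMap.id (epsAt A CA k))))
      (LinearMap.prod
        ((embT A CA k).comp ((TensorProduct.lid R (A k)).toLinearMap.comp
          (TensorProduct.map (epsAt A CA i) LinearMap.id)))
        ((epsAt A CA i).comp ((TensorProduct.rid R (A i)).toLinearMap.comp
          (TensorProduct.map LinearMap.id (epsAt A CA k))))))

theorem tensorParts_tmul (i k : ℕ) (x : A i) (x' : A k) :
    tensorParts CA i k (x ⊗ₜ x') = (embT A CA i x ⊗ₜ embT A CA k x',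
      epsAt A CA k x' • embT A CA i x, epsAt A CA i x • embT A CA k x',
      epsAt A CA k x' • epsAt A CA i x) := by
  simp [tensorParts]

theorem diagSum_prod {M N : Type} [AddCommGroup M] [Module R M] [AddCommGroup N] [Module R N]
    (F : ∀ i k, (A i ⊗[R] A k) →ₗ[R] M) (G : ∀ i k, (A i ⊗[R] A k) →ₗ[R] N) (p : ℕ) (x : A p) :
    diagSum CA (fun i k => (F i k).prod (G i k)) p x = (diagSum CA F p x, diagSum CA G p x) := by
  refine Prod.ext ?_ ?_ <;>
    simp only [diagSum, LinearMap.sum_apply, LinearMap.comp_apply, LinearMap.prod_apply,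
      Prod.fst_sum, Prod.snd_sum, Function.prod]

theorem diagSum_tensorParts (p : ℕ) (x : A p) :
    diagSum CA (tensorParts CA) p x
      = (bigDiag A CA p x, embT A CA p x, embT A CA p x, epsAt A CA p x) := by
  unfold tensorParts
  rw [diagSum_prod, diagSum_prod, diagSum_prod, diagSum_rid CA (fun i => embT A CA i),
    diagSum_lid CA (fun i => embT A CA i), diagSum_rid CA (fun i => epsAt A CA i),
    ← bigDiag_eq_diagSum]

section Mul2

variable {M N P : Type} [AddCommGroup M] [Module R M] [AddCommGroup N] [Module R N]
  [Ring P] [Algebra R P]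

theorem mul2_add_left (f f' : M →ₗ[R] P) (g : N →ₗ[R] P) :
    mul2 (f + f') g = mul2 f g + mul2 f' g := by
  ext; simp [add_mul]

theorem mul2_add_right (f : M →ₗ[R] P) (g g' : N →ₗ[R] P) :
    mul2 f (g + g') = mul2 f g + mul2 f g' := by
  ext; simp [mul_add]

theorem mul2_smul_left (c : R) (f : M →ₗ[R] P) (g : N →ₗ[R] P) :
    mul2 (c • f) g = c • mul2 f g := by
  ext; simp

theorem mul2_smul_right (c : R) (f : M →ₗ[R] P) (g : N →ₗ[R] P) :
    mul2 f (c • g) = c • mul2 f g := by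
  ext; simp

@[simp] theorem mul2_zero_left (g : N →ₗ[R] P) : mul2 (0 : M →ₗ[R] P) g = 0 := by
  ext; simp

@[simp] theorem mul2_zero_right (f : M →ₗ[R] P) : mul2 f (0 : N →ₗ[R] P) = 0 := by
  ext; simp

end Mul2

/-- The quadratic part of the cobar differential as a bilinear expression in the components
of the two diagonals. -/
def quadForm : ((Big A CA ⊗[R] Big A CA) × Big A CA × Big A CA × R) →ₗ[R]
    ((Big B CB ⊗[R] Big B CB) × Big B CB × Big B CB × R) →ₗ[R] Om A CA B CB :=
  LinearMap.mk₂ R (fun X Y =>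
      mul2 (genTL CA CB) (genTL CA CB) (TensorProduct.tensorTensorTensorComm R _ _ _ _ (X.1 ⊗ₜ Y.1))
      + mul2 ((genTB CA CB).flip Y.2.1) (genAL CA CB) X.1
      + mul2 (genTB CA CB X.2.1) (genBL CA CB) Y.1
      + mul2 (genAL CA CB) ((genTB CA CB).flip Y.2.2.1) X.1
      + Y.2.2.2 • mul2 (genAL CA CB) (genAL CA CB) X.1
      + genAL CA CB X.2.1 * genBL CA CB Y.2.2.1
      + mul2 (genBL CA CB) (genTB CA CB X.2.2.1) Y.1
      + genBL CA CB Y.2.1 * genAL CA CB X.2.2.1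
      + X.2.2.2 • mul2 (genBL CA CB) (genBL CA CB) Y.1)
    (fun X X' Y => by
      simp only [Prod.fst_add, Prod.snd_add, TensorProduct.add_tmul, map_add, mul2_add_left,
        mul2_add_right, LinearMap.add_apply, add_mul, mul_add, smul_add, add_smul]
      abel)
    (fun c X Y => by
      simp only [Prod.smul_fst, Prod.smul_snd, ← TensorProduct.smul_tmul', map_smul,
        mul2_smul_left, mul2_smul_right, LinearMap.smul_apply, smul_mul_assoc, mul_smul_comm,
        smul_add, smul_assoc]
      simp only [smul_comm c])
    (fun X Y Y' => by
      simp only [Prod.fst_add, Prod.snd_add, TensorProduct.tmul_add, map_add, mul2_add_left,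
        mul2_add_right, LinearMap.add_apply, add_mul, mul_add, smul_add, add_smul]
      abel)
    (fun c X Y => by
      simp only [Prod.smul_fst, Prod.smul_snd, TensorProduct.tmul_smul, map_smul,
        mul2_smul_left, mul2_smul_right, LinearMap.smul_apply, smul_mul_assoc, mul_smul_comm,
        smul_add, smul_assoc]
      simp only [smul_comm c])

theorem quadForm_apply (X : (Big A CA ⊗[R] Big A CA) × Big A CA × Big A CA × R)
    (Y : (Big B CB ⊗[R] Big B CB) × Big B CB × Big B CB × R) :
    quadForm CA CB X Y =
      mul2 (genTL CA CB) (genTL CA CB) (TensorProduct.tensorTensorTensorComm R _ _ _ _ (X.1 ⊗ₜ Y.1))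
      + mul2 ((genTB CA CB).flip Y.2.1) (genAL CA CB) X.1
      + mul2 (genTB CA CB X.2.1) (genBL CA CB) Y.1
      + mul2 (genAL CA CB) ((genTB CA CB).flip Y.2.2.1) X.1
      + Y.2.2.2 • mul2 (genAL CA CB) (genAL CA CB) X.1
      + genAL CA CB X.2.1 * genBL CA CB Y.2.2.1
      + mul2 (genBL CA CB) (genTB CA CB X.2.2.1) Y.1
      + genBL CA CB Y.2.1 * genAL CA CB X.2.2.1
      + X.2.2.2 • mul2 (genBL CA CB) (genBL CA CB) Y.1 := rfl

theorem mul2_genW_eq_quadForm (i i' k k' : ℕ) (X : A i ⊗[R] A i') (Y : B k ⊗[R] B k') :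
    mul2 ((TensorAlgebra.ι R).comp (Γg A CA B CB i k))
        ((TensorAlgebra.ι R).comp (Γg A CA B CB i' k'))
        (TensorProduct.tensorTensorTensorComm R (A i) (A i') (B k) (B k') (X ⊗ₜ Y))
      = quadForm CA CB (tensorParts CA i i' X) (tensorParts CB k k' Y) := by
  induction X with
  | zero => simp
  | add X X' h h' => simp only [TensorProduct.add_tmul, map_add, LinearMap.add_apply, h, h']
  | tmul x x' =>
    induction Y with
    | zero => simp
    | add Y Y' h h' => simp only [TensorProduct.tmul_add, map_add, h, h']
    | tmul y y' =>
      rw [TensorProduct.tensorTensorTensorComm_tmul, mul2_tmul]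
      change genW A CA B CB i k (x ⊗ₜ y) * genW A CA B CB i' k' (x' ⊗ₜ y') = _
      rw [genW_tmul, genW_tmul, quadForm_apply, tensorParts_tmul, tensorParts_tmul]
      simp only [TensorProduct.tensorTensorTensorComm_tmul, mul2_tmul, genTL_tmul,
        LinearMap.flip_apply, map_smul, LinearMap.smul_apply, mul_add, add_mul, smul_mul_assoc,
        mul_smul_comm, smul_add, smul_smul, smul_eq_mul]
      have hc : ∀ c c' : R, c * c' = c' * c := mul_comm
      simp only [hc]
      abel

theorem epsAt_d (p : ℕ) (x : A (p+1)) : epsAt A CA p (CA.d p x) = 0 := by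
  cases p with
  | zero => exact CA.counit_d x
  | succ p => rfl

theorem embD_coaug (r : R) : embD CA 0 (CA.coaug r) = 0 := rfl

theorem epsAt_coaug_one : epsAt A CA 0 (CA.coaug 1) = 1 := CA.counit_coaug

theorem genW_coaug_right (p : ℕ) (x : A p) :
    genW A CA B CB p 0 (x ⊗ₜ CB.coaug 1) = genAL CA CB (embT A CA p x) := by
  simp [genW_tmul, embT_coaug, epsAt_coaug_one]

theorem genW_coaug_left (q : ℕ) (y : B q) :
    genW A CA B CB 0 q (CA.coaug 1 ⊗ₜ y) = genBL CA CB (embT B CB q y) := by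
  simp [genW_tmul, embT_coaug, epsAt_coaug_one]

theorem linT1_tmul (p q : ℕ) (x : A p) (y : B q) :
    linT1 A CA B CB p q (x ⊗ₜ y)
      = genTB CA CB (embD CA p x) (embT B CB q y) + epsAt B CB q y • genAL CA CB (embD CA p x) := by
  cases p with
  | zero => simp [linT1, embD]
  | succ p =>
    change genW A CA B CB p q (CA.d p x ⊗ₜ y) = _
    rw [genW_tmul, epsAt_d, zero_smul, add_zero]
    rfl

variable [CharP R 2]

theorem quadT_tmul (p q : ℕ) (x : A p) (y : B q) :
    quadT A CA B CB p q (x ⊗ₜ y)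
      = quadForm CA CB (bigDiag A CA p x, embT A CA p x, embT A CA p x, epsAt A CA p x)
          (bigDiag B CB q y, embT B CB q y, embT B CB q y, epsAt B CB q y) := by
  rw [← diagSum_tensorParts, ← diagSum_tensorParts, diagSum, diagSum, quadT]
  simp only [LinearMap.sum_apply, map_sum, neg_one_pow_zsmul (R := R),
    LinearMap.comp_apply, TensorProduct.map_tmul, LinearEquiv.coe_coe, mul2_genW_eq_quadForm]
  exact Finset.sum_comm

theorem linT2_tmul (p q : ℕ) (x : A p) (y : B q) :
    linT2 A CA B CB p q (x ⊗ₜ y)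
      = genTB CA CB (embT A CA p x) (embD CB q y) + epsAt A CA p x • genBL CA CB (embD CB q y) := by
  cases q with
  | zero => simp [linT2, embD]
  | succ q =>
    have h : linT2 A CA B CB p (q+1) (x ⊗ₜ y)
        = ((-1 : ℤ)^p) • genW A CA B CB p q (x ⊗ₜ CB.d q y) := by
      cases p <;> rfl
    rw [h, neg_one_pow_zsmul (R := R), genW_tmul, epsAt_d, zero_smul, add_zero]
    rfl

theorem dvalT_tmul (p q : ℕ) (x : A p) (y : B q) :
    dvalT A CA B CB p q (x ⊗ₜ y)
      = genTB CA CB (embD CA p x) (embT B CB q y) + epsAt B CB q y • genAL CA CB (embD CA p x)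
        + (genTB CA CB (embT A CA p x) (embD CB q y) + epsAt A CA p x • genBL CA CB (embD CB q y))
        + quadForm CA CB (bigDiag A CA p x, embT A CA p x, embT A CA p x, epsAt A CA p x)
          (bigDiag B CB q y, embT B CB q y, embT B CB q y, epsAt B CB q y) := by
  have hneg : ∀ w : Om A CA B CB, -w = w := fun w => by
    rw [← neg_one_zsmul, ← pow_one (-1 : ℤ), neg_one_pow_zsmul (R := R)]
  rw [dvalT, LinearMap.add_apply, LinearMap.sub_apply, LinearMap.neg_apply, sub_eq_add_neg, hneg,
    hneg, linT1_tmul, linT2_tmul, quadT_tmul]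

section Differential

variable (D : Om A CA B CB →ₗ[R] Om A CA B CB)
  (hDgen : ∀ (p q : ℕ) (z : A p ⊗[R] B q),
    D (genW A CA B CB p q z) = dvalT A CA B CB p q z)

include hDgen

theorem differential_genA (v : Big A CA) :
    D (genAL CA CB v)
      = genAL CA CB (redD CA v) + mul2 (genAL CA CB) (genAL CA CB) (redDiag CA v) := by
  induction v using big_induction CA with
  | zero => simp
  | add v w hv hw => simp only [map_add, hv, hw]; abel
  | emb p x =>
    rw [← genW_coaug_right, hDgen, dvalT_tmul, redD_embT, redDiag_embT, quadForm_apply]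
    simp [embT_coaug, epsAt_coaug_one, embD_coaug, bigDiag_coaug]

theorem differential_genB (u : Big B CB) :
    D (genBL CA CB u)
      = genBL CA CB (redD CB u) + mul2 (genBL CA CB) (genBL CA CB) (redDiag CB u) := by
  induction u using big_induction CB with
  | zero => simp
  | add v w hv hw => simp only [map_add, hv, hw]; abel
  | emb p x =>
    rw [← genW_coaug_left, hDgen, dvalT_tmul, redD_embT, redDiag_embT, quadForm_apply]
    simp [embT_coaug, epsAt_coaug_one, embD_coaug, bigDiag_coaug]

theorem differential_genT (v : Big A CA) (u : Big B CB) :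
    D (genTB CA CB v u)
      = genTB CA CB (redD CA v) u + genTB CA CB v (redD CB u)
        + genAL CA CB v * genBL CA CB u + genBL CA CB u * genAL CA CB v
        + mul2 (genTB CA CB v) (genBL CA CB) (redDiag CB u)
        + mul2 (genBL CA CB) (genTB CA CB v) (redDiag CB u)
        + (mul2 ((genTB CA CB).flip u) (genAL CA CB) (redDiag CA v)
          + mul2 (genAL CA CB) ((genTB CA CB).flip u) (redDiag CA v)
          + mul2 (genTL CA CB) (genTL CA CB)
            (TensorProduct.tensorTensorTensorComm R _ _ _ _ (redDiag CA v ⊗ₜ redDiag CB u))) := by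
  induction v using big_induction CA with
  | zero => simp
  | add v w hv hw =>
    simp only [map_add, LinearMap.add_apply, hv, hw, mul2_add_left, mul2_add_right,
      TensorProduct.add_tmul, add_mul, mul_add]
    abel
  | emb p x =>
    induction u using big_induction CB with
    | zero => simp
    | add v w hv hw =>
      simp only [map_add, LinearMap.add_apply, hv, hw, mul2_add_left, mul2_add_right,
        TensorProduct.tmul_add, add_mul, mul_add]
      abel
    | emb q y =>
      have h := hDgen p q (x ⊗ₜ y)
      rw [genW_tmul, dvalT_tmul, map_add, map_add, map_smul, map_smul,
        differential_genA CA CB D hDgen, differential_genB CA CB D hDgen, quadForm_apply] at h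
      simp only [redD_embT, redDiag_embT, smul_add] at h ⊢
      rw [add_assoc, ← eq_sub_iff_add_eq] at h
      rw [h]
      abel

variable (hDmul : ∀ (p q : ℕ) (z : A p ⊗[R] B q) (w : Om A CA B CB),
    D (genW A CA B CB p q z * w)
      = dvalT A CA B CB p q z * w + genW A CA B CB p q z * D w)
  (hD_one : D 1 = 0)

include hDmul hD_one

omit [CharP R 2] in
theorem differential_mul (w w' : Om A CA B CB) : D (w * w') = D w * w' + w * D w' := by
  have hW : ∀ (p q : ℕ) (z : A p ⊗[R] B q) (w : Om A CA B CB),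
      D (genW A CA B CB p q z * w) = D (genW A CA B CB p q z) * w + genW A CA B CB p q z * D w :=
    fun p q z w => by rw [hDmul, hDgen]
  have hA : ∀ v w, D (genAL CA CB v * w) = D (genAL CA CB v) * w + genAL CA CB v * D w := by
    intro v w
    induction v using big_induction CA with
    | zero => simp
    | add v v' h h' => simp only [map_add, add_mul, h, h']; abel
    | emb p x => rw [← genW_coaug_right, hW]
  have hB : ∀ v w, D (genBL CA CB v * w) = D (genBL CA CB v) * w + genBL CA CB v * D w := by
    intro v w
    induction v using big_induction CB with
    | zero => simp
    | add v v' h h' => simp only [map_add, add_mul, h, h']; abel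
    | emb p x => rw [← genW_coaug_left, hW]
  have hT : ∀ v u w, D (genTB CA CB v u * w)
      = D (genTB CA CB v u) * w + genTB CA CB v u * D w := by
    intro v u w
    induction v using big_induction CA with
    | zero => simp
    | add v v' h h' => simp only [map_add, LinearMap.add_apply, add_mul, h, h']; abel
    | emb p x =>
      induction u using big_induction CB with
      | zero => simp
      | add v v' h h' => simp only [map_add, add_mul, h, h']; abel
      | emb q y =>
        have h := hW p q (x ⊗ₜ y) w
        simp only [genW_tmul, add_mul, map_add, smul_mul_assoc, map_smul, hA, hB] at h
        rw [add_assoc, ← eq_sub_iff_add_eq] at h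
        rw [h]
        simp only [smul_add]
        abel
  have hι : ∀ x w, D (TensorAlgebra.ι R x * w)
      = D (TensorAlgebra.ι R x) * w + TensorAlgebra.ι R x * D w := by
    have hTt : ∀ t w, D (genTL CA CB t * w)
        = D (genTL CA CB t) * w + genTL CA CB t * D w := by
      intro t w
      induction t with
      | zero => simp
      | add t t' h h' => simp only [map_add, add_mul, h, h']; abel
      | tmul v u => exact hT v u w
    rintro ⟨t, v, u⟩ w
    have hx : TensorAlgebra.ι R (t, v, u)
        = genTL CA CB t + genAL CA CB v + genBL CA CB u := by
      simp only [genTL, genAL, genBL, LinearMap.comp_apply, ← map_add]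
      simp [lT, lA, lB]
    rw [hx]
    simp only [map_add, add_mul, hTt, hA, hB]
    abel
  induction w using TensorAlgebra.induction generalizing w' with
  | algebraMap r =>
    rw [Algebra.algebraMap_eq_smul_one, map_smul, hD_one, smul_zero, zero_mul, zero_add,
      smul_one_mul, smul_one_mul, map_smul]
  | ι x => exact hι x w'
  | mul a b ha hb => rw [mul_assoc, ha, hb, ha b]; simp only [mul_add, add_mul, mul_assoc]; abel
  | add a b ha hb => simp only [map_add, add_mul, ha, hb]; abel

end Differential

end Generators
section Homotopy

variable {R : Type} [CommRing R]
variable {A : ℕ → Type} [∀ n, AddCommGroup (A n)] [∀ n, Module R (A n)] (CA : CoalgStr R A)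
variable {B : ℕ → Type} [∀ n, AddCommGroup (B n)] [∀ n, Module R (B n)] (CB : CoalgStr R B)

theorem wordA_nil : wordA A CA B CB [] = 1 := rfl

theorem wordA_append_singleton (l : List ((p : ℕ) × A p)) (t : (p : ℕ) × A p) :
    wordA A CA B CB (l ++ [t]) = wordA A CA B CB l * genAL CA CB (embT A CA t.1 t.2) := by
  simp only [wordA, List.map_append, List.prod_append, List.map_singleton, List.prod_singleton]
  rfl

/-- The span of the words in letters from `Ā`. -/
def wordSpan : Submodule R (Om A CA B CB) := Submodule.span R (Set.range (wordA A CA B CB))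

theorem wordA_mem_wordSpan (l : List ((p : ℕ) × A p)) :
    wordA A CA B CB l ∈ wordSpan CA CB :=
  Submodule.subset_span ⟨l, rfl⟩

theorem mul_genAL_mem_wordSpan {α : Om A CA B CB} (hα : α ∈ wordSpan CA CB) (v : Big A CA) :
    α * genAL CA CB v ∈ wordSpan CA CB := by
  induction hα using Submodule.span_induction with
  | mem α hα =>
    obtain ⟨l, rfl⟩ := hα
    induction v using big_induction CA with
    | zero => simp
    | emb p x =>
      rw [← wordA_append_singleton CA CB l ⟨p, x⟩]
      exact wordA_mem_wordSpan CA CB _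
    | add v w hv hw => rw [map_add, mul_add]; exact add_mem hv hw
  | zero => simp
  | add α β _ _ hα hβ => rw [add_mul]; exact add_mem hα hβ
  | smul c α _ hα => rw [smul_mul_assoc]; exact Submodule.smul_mem _ c hα

theorem mul_mul2_genAL_mem_wordSpan {α : Om A CA B CB} (hα : α ∈ wordSpan CA CB)
    (t : Big A CA ⊗[R] Big A CA) :
    α * mul2 (genAL CA CB) (genAL CA CB) t ∈ wordSpan CA CB := by
  induction t with
  | zero => simp
  | add t t' ht ht' => rw [map_add, mul_add]; exact add_mem ht ht'
  | tmul v w =>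
    rw [mul2_tmul, ← mul_assoc]
    exact mul_genAL_mem_wordSpan CA CB (mul_genAL_mem_wordSpan CA CB hα v) w

theorem differential_wordA_mem_wordSpan (D : Om A CA B CB →ₗ[R] Om A CA B CB)
    (hD : ∀ x y, D (x * y) = D x * y + x * D y) (hD_one : D 1 = 0)
    (hDA : ∀ v, D (genAL CA CB v)
      = genAL CA CB (redD CA v) + mul2 (genAL CA CB) (genAL CA CB) (redDiag CA v))
    (l : List ((p : ℕ) × A p)) : D (wordA A CA B CB l) ∈ wordSpan CA CB := by
  induction l using List.reverseRecOn with
  | nil => rw [wordA_nil, hD_one]; exact zero_mem _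
  | append_singleton l t ih =>
    rw [wordA_append_singleton, hD, hDA, mul_add]
    exact add_mem (mul_genAL_mem_wordSpan CA CB ih _)
      (add_mem (mul_genAL_mem_wordSpan CA CB (wordA_mem_wordSpan CA CB l) _)
        (mul_mul2_genAL_mem_wordSpan CA CB (wordA_mem_wordSpan CA CB l) _))

/-- The bilinear map `(α, b) ↦ h [b | α]`. -/
def blockH (h : Om A CA B CB →ₗ[R] Om A CA B CB) :
    Om A CA B CB →ₗ[R] Big B CB →ₗ[R] Om A CA B CB :=
  ((LinearMap.mul R (Om A CA B CB)).flip.compl₂ (genBL CA CB)).compr₂ h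

theorem blockH_apply (h : Om A CA B CB →ₗ[R] Om A CA B CB) (α : Om A CA B CB) (u : Big B CB) :
    blockH CA CB h α u = h (genBL CA CB u * α) := rfl

variable (h : Om A CA B CB →ₗ[R] Om A CA B CB)

theorem blockH_mul_genAL
    (hRec : ∀ (q : ℕ) (b : B q) (α : List ((p : ℕ) × A p)) (x : Big A CA),
      h (genB A CA B CB (embT B CB q b) * wordA A CA B CB α * genA A CA B CB x)
        = wordA A CA B CB α * genT A CA B CB (x ⊗ₜ[R] embT B CB q b)
          + h (genB A CA B CB (embT B CB q b) * wordA A CA B CB α) * genA A CA B CB x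
          + sweedC A CA B CB h α x (bigDiag B CB q b))
    {α : Om A CA B CB} (hα : α ∈ wordSpan CA CB) (v : Big A CA) :
    blockH CA CB h (α * genAL CA CB v)
      = α • genTB CA CB v + MulOpposite.op (genAL CA CB v) • blockH CA CB h α
        + conv (redDiag CB) (blockH CA CB h α) (genTB CA CB v) := by
  refine mul_right_formula_of_mem_span (redDiag CB) (genTB CA CB v) (blockH CA CB h) _ _ ?_ hα
  rintro _ ⟨l, rfl⟩
  refine LinearMap.ext fun u => ?_
  induction u using big_induction CB with
  | zero => simp only [map_zero]
  | add u w hu hw => rw [map_add, map_add, hu, hw]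
  | emb q b =>
    rw [blockH_apply, ← mul_assoc]
    refine (hRec q b l v).trans ?_
    rw [LinearMap.add_apply, LinearMap.add_apply, conv_apply, redDiag_embT]
    rfl

theorem h_mul2_genBL_mul_wordA
    (hRec : ∀ (ω : Om A CA B CB) (q : ℕ) (b : B q) (α : List ((p : ℕ) × A p)),
      α ≠ [] → ∀ β : List ((r : ℕ) × B r),
      h (ω * genB A CA B CB (embT B CB q b) * wordA A CA B CB α * wordB A CA B CB β)
        = ω * h (genB A CA B CB (embT B CB q b) * wordA A CA B CB α) * wordB A CA B CB β
          + h (ω * wordA A CA B CB α * genB A CA B CB (embT B CB q b) * wordB A CA B CB β))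
    (hZero : ∀ (α : List ((p : ℕ) × A p)) (β : List ((r : ℕ) × B r)),
      h (wordA A CA B CB α * wordB A CA B CB β) = 0)
    (l : List ((p : ℕ) × A p)) (t : Big B CB ⊗[R] Big B CB) :
    h (mul2 (genBL CA CB) (genBL CA CB) t * wordA A CA B CB l)
      = mul2 (genBL CA CB) (blockH CA CB h (wordA A CA B CB l)) t
        + mul2 (blockH CA CB h (wordA A CA B CB l)) (genBL CA CB) t := by
  induction t with
  | zero => simp
  | add t t' ht ht' => simp only [map_add, add_mul, ht, ht']; abel
  | tmul u u' =>
    simp only [mul2_tmul]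
    induction u using big_induction CB with
    | zero => simp
    | add u w hu hw => simp only [map_add, add_mul, hu, hw]; abel
    | emb q b =>
      induction u' using big_induction CB with
      | zero => simp
      | add u w hu hw => simp only [map_add, add_mul, mul_add, hu, hw]; abel
      | emb q' b' =>
        have h1 : ∀ (q : ℕ) (b : B q), wordB A CA B CB [⟨q, b⟩]
            = genB A CA B CB (embT B CB q b) := fun q b => by
          simp [wordB]
        have h2 : wordB A CA B CB [⟨q, b⟩, ⟨q', b'⟩]
            = genB A CA B CB (embT B CB q b) * genB A CA B CB (embT B CB q' b') := by
          simp [wordB]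
        have hz := hZero l [⟨q, b⟩, ⟨q', b'⟩]
        rw [h2] at hz
        simp only [blockH_apply]
        change h (genB A CA B CB (embT B CB q b) * genB A CA B CB (embT B CB q' b') * _)
          = genB A CA B CB (embT B CB q b) * h (genB A CA B CB (embT B CB q' b') * _)
            + h (genB A CA B CB (embT B CB q b) * _) * genB A CA B CB (embT B CB q' b')
        rcases eq_or_ne l [] with rfl | hl
        · have hs : ∀ (q : ℕ) (b : B q), h (genB A CA B CB (embT B CB q b)) = 0 := fun q b => by
            have := hZero [] [⟨q, b⟩]
            rwa [h1, wordA_nil, one_mul] at this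
          rw [wordA_nil, one_mul] at hz
          rw [wordA_nil, mul_one, mul_one, mul_one, hs, hs, hz]
          simp
        · have r1 := hRec (genB A CA B CB (embT B CB q b)) q' b' l hl []
          have r2 := hRec 1 q b l hl [⟨q', b'⟩]
          have h0 : wordB A CA B CB [] = 1 := rfl
          rw [h0, mul_one, mul_one, mul_one] at r1
          rw [h1, one_mul, one_mul, one_mul, mul_assoc (wordA A CA B CB l), hz, add_zero] at r2
          rw [r1, r2]

section Formula

variable [CharP R 2] (D : Om A CA B CB →ₗ[R] Om A CA B CB)
  (hDgen : ∀ (p q : ℕ) (z : A p ⊗[R] B q), D (genW A CA B CB p q z) = dvalT A CA B CB p q z)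
  (hD : ∀ x y, D (x * y) = D x * y + x * D y) (hD_one : D 1 = 0)

include hDgen hD hD_one

/-- The formula for the differential of `b ↦ h [b | α]` for a word `α` of letters
from `Ā`. -/
theorem differential_comp_blockH
    (hZero : ∀ (α : List ((p : ℕ) × A p)) (β : List ((r : ℕ) × B r)),
      h (wordA A CA B CB α * wordB A CA B CB β) = 0)
    (hRec : ∀ (q : ℕ) (b : B q) (α : List ((p : ℕ) × A p)) (x : Big A CA),
      h (genB A CA B CB (embT B CB q b) * wordA A CA B CB α * genA A CA B CB x)
        = wordA A CA B CB α * genT A CA B CB (x ⊗ₜ[R] embT B CB q b)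
          + h (genB A CA B CB (embT B CB q b) * wordA A CA B CB α) * genA A CA B CB x
          + sweedC A CA B CB h α x (bigDiag B CB q b))
    (l : List ((p : ℕ) × A p)) :
    D ∘ₗ blockH CA CB h (wordA A CA B CB l)
      = blockH CA CB h (wordA A CA B CB l) ∘ₗ redD CB
        + conv (redDiag CB) (genBL CA CB) (blockH CA CB h (wordA A CA B CB l))
        + conv (redDiag CB) (blockH CA CB h (wordA A CA B CB l)) (genBL CA CB)
        + blockH CA CB h (D (wordA A CA B CB l))
        + wordA A CA B CB l • genBL CA CB
        + MulOpposite.op (wordA A CA B CB l) • genBL CA CB := by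
  induction l using List.reverseRecOn with
  | nil =>
    have h1 : blockH CA CB h 1 = 0 := by
      refine LinearMap.ext fun u => ?_
      induction u using big_induction CB with
      | zero => simp only [map_zero]
      | add u w hu hw => rw [map_add, map_add, hu, hw]
      | emb q b =>
        have := hZero [] [⟨q, b⟩]
        rw [wordA_nil, one_mul] at this
        rw [blockH_apply, mul_one]
        simp only [wordB, List.map_singleton, List.prod_singleton] at this
        exact this
    have h2 : genBL CA CB + genBL CA CB = 0 := by
      rw [← two_smul R, CharTwo.two_eq_zero, zero_smul]
    simp [wordA_nil, h1, hD_one, h2]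
  | append_singleton l t ih =>
    obtain ⟨s, hs⟩ := TensorProduct.exists_finset (redDiag CA (embT A CA t.1 t.2))
    rw [wordA_append_singleton]
    refine homotopy_formula_step (redDiag CB) (redDiag_coassoc CB) (redD CB) (redDiag_redD CB)
      D hD (genBL CA CB) (genTB CA CB) (genAL CA CB) (blockH CA CB h) (wordSpan CA CB)
      (fun α hα v => mul_genAL_mem_wordSpan CA CB hα v)
      (fun α hα v => blockH_mul_genAL CA CB h hRec hα v) _ (wordA_mem_wordSpan CA CB l)
      (differential_wordA_mem_wordSpan CA CB D hD hD_one
        (differential_genA CA CB D hDgen) l)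
      _ (redD CA (embT A CA t.1 t.2)) s Prod.fst Prod.snd ?_ ?_ ih
    · rw [differential_genA CA CB D hDgen, hs, map_sum]
      rfl
    · have hTT : ∀ (p q : Big A CA) (Y : Big B CB ⊗[R] Big B CB),
          mul2 (genTL CA CB) (genTL CA CB)
            (TensorProduct.tensorTensorTensorComm R _ _ _ _ ((p ⊗ₜ q) ⊗ₜ Y))
          = mul2 (genTB CA CB p) (genTB CA CB q) Y := by
        intro p q Y
        induction Y with
        | zero => simp
        | add Y Y' hY hY' => rw [TensorProduct.tmul_add, map_add, map_add, map_add, hY, hY']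
        | tmul u u' => rfl
      intro u
      rw [differential_genT CA CB D hDgen, hs]
      simp only [TensorProduct.sum_tmul, map_sum, hTT, mul2_tmul, LinearMap.flip_apply,
        Finset.sum_add_distrib]

end Formula

end Homotopy
/-- Let `A`, `B` be coaugmented chain coalgebras over a commutative
ring `R` of characteristic 2, and `h` the natural degree `+1` homotopy on `Ω (A ⊗ B)`.
Then for all `b ∈ B̄` and `a₁, …, a_n ∈ Ā`,
`(dh + hd)[b | a₁ | ⋯ | a_n] = [a₁ | ⋯ | a_n | b] + [b | a₁ | ⋯ | a_n]`. -/
theorem homotopy_block_lemma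
    (R : Type) [CommRing R] [CharP R 2]
    (A : ℕ → Type) [∀ n, AddCommGroup (A n)] [∀ n, Module R (A n)] (CA : CoalgStr R A)
    (B : ℕ → Type) [∀ n, AddCommGroup (B n)] [∀ n, Module R (B n)] (CB : CoalgStr R B)
    -- the cobar differential of Ω (A ⊗ B)
    (dOm : Om A CA B CB →ₗ[R] Om A CA B CB)
    (hdOm1 : dOm 1 = 0)
    (hdOmL : ∀ (p q : ℕ) (z : A p ⊗[R] B q) (u : Om A CA B CB),
      dOm (genW A CA B CB p q z * u)
        = dvalT A CA B CB p q z * u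
          + ((-1 : ℤ)^(p+q+1)) • (genW A CA B CB p q z * dOm u))
    -- the natural homotopy h, characterized by its defining recursion (mod 2)
    (h : Om A CA B CB →ₗ[R] Om A CA B CB)
    (hh1 : h 1 = 0)
    (hhEnd : ∀ (u : Om A CA B CB) (t : Big A CA ⊗[R] Big B CB), h (u * genT A CA B CB t) = 0)
    (hhBase : ∀ (p q : ℕ) (a : A p) (b : B q),
      h (genB A CA B CB (embT B CB q b) * genA A CA B CB (embT A CA p a))
        = genT A CA B CB (embT A CA p a ⊗ₜ[R] embT B CB q b))
    (hhRec1 : ∀ (q : ℕ) (b : B q) (α : List ((p : ℕ) × A p)) (x : Big A CA),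
      h (genB A CA B CB (embT B CB q b) * wordA A CA B CB α * genA A CA B CB x)
        = wordA A CA B CB α * genT A CA B CB (x ⊗ₜ[R] embT B CB q b)
          + h (genB A CA B CB (embT B CB q b) * wordA A CA B CB α) * genA A CA B CB x
          + sweedC A CA B CB h α x (bigDiag B CB q b))
    (hhRec2 : ∀ (ω : Om A CA B CB) (q : ℕ) (b : B q) (α : List ((p : ℕ) × A p)),
      α ≠ [] → ∀ β : List ((r : ℕ) × B r),
      h (ω * genB A CA B CB (embT B CB q b) * wordA A CA B CB α * wordB A CA B CB β)
        = ω * h (genB A CA B CB (embT B CB q b) * wordA A CA B CB α) * wordB A CA B CB β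
          + h (ω * wordA A CA B CB α * genB A CA B CB (embT B CB q b) * wordB A CA B CB β))
    (hhZero1 : ∀ (α : List ((p : ℕ) × A p)) (β : List ((r : ℕ) × B r)),
      h (wordA A CA B CB α * wordB A CA B CB β) = 0)
    (hhZero2 : ∀ (ω : Om A CA B CB) (t : Big A CA ⊗[R] Big B CB)
        (α : List ((p : ℕ) × A p)) (β : List ((r : ℕ) × B r)),
      h (ω * genT A CA B CB t * wordA A CA B CB α * wordB A CA B CB β) = 0)
    : ∀ (q : ℕ) (b : B q) (l : List ((p : ℕ) × A p)),
      dOm (h (genB A CA B CB (embT B CB q b) * wordA A CA B CB l))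
        + h (dOm (genB A CA B CB (embT B CB q b) * wordA A CA B CB l))
      = wordA A CA B CB l * genB A CA B CB (embT B CB q b)
        + genB A CA B CB (embT B CB q b) * wordA A CA B CB l := by
  have hDgen : ∀ (p q : ℕ) (z : A p ⊗[R] B q),
      dOm (genW A CA B CB p q z) = dvalT A CA B CB p q z := fun p q z => by
    have hz := hdOmL p q z 1
    rwa [mul_one, mul_one, hdOm1, mul_zero, smul_zero, add_zero] at hz
  have hD : ∀ w w', dOm (w * w') = dOm w * w' + w * dOm w' :=
    differential_mul CA CB dOm hDgen
      (fun p q z w => by rw [hdOmL, neg_one_pow_zsmul (R := R)]) hdOm1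
  intro q b l
  have hB : ∀ u, genB A CA B CB u = genBL CA CB u := fun _ => rfl
  have hH := LinearMap.congr_fun
    (differential_comp_blockH CA CB h dOm hDgen hD hdOm1 hhZero1 hhRec1 l) (embT B CB q b)
  have hBB := h_mul2_genBL_mul_wordA CA CB h hhRec2 hhZero1 l (redDiag CB (embT B CB q b))
  simp only [LinearMap.comp_apply, LinearMap.add_apply, LinearMap.smul_apply, smul_eq_mul,
    MulOpposite.smul_eq_mul_unop, MulOpposite.unop_op, conv_apply] at hH
  rw [hB, hD, differential_genB CA CB dOm hDgen, add_mul, map_add, map_add, hBB, ← blockH_apply,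
    ← blockH_apply, ← blockH_apply, hH]
  have h_two : ∀ w : Om A CA B CB, (2 : ℤ) • w = 0 := fun w => by
    rw [two_smul, ← two_smul R, CharTwo.two_eq_zero, zero_smul]
  abel_nf
  simp only [h_two, zero_add]

end CJ2
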